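/- Let n ≥ 1 and λ > 1, set ε = 1/(λ^(n + 1/2) + 1) (real power), A = [[1, λ], [λ, 1]], and D = (ε/2)·A ⊗ E00 + (1/2)·(I₂ − εA) ⊗ E11. Let V = e_{(0,0)}^{⊗n} ⊗ e_{(0,1)} + e_{(1,0)}^{⊗n} ⊗ e_{(1,1)} ∈ ℂ^(4^(n+1)). Then ⟨V, D^{⊗(n+1)} V⟩ < 0; in particular, D^{⊗(n+1)} violates the positivity axiom on the 0/1 vector V. -/

import Mathlib

open Matrix BigOperators ComplexOrder Kronecker

/-- The 2×2 matrix `A = [[1, λ], [λ, 1]]`, viewed as a complex matrix. -/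
noncomputable def Amat (lam : ℝ) : Matrix (Fin 2) (Fin 2) ℂ :=
  !![1, (lam : ℂ); (lam : ℂ), 1]

/-- The rank-one projector `E00 = e₀e₀†` on `ℂ²`. -/
def E00 : Matrix (Fin 2) (Fin 2) ℂ := !![1, 0; 0, 0]

/-- The rank-one projector `E11 = e₁e₁†` on `ℂ²`. -/
def E11 : Matrix (Fin 2) (Fin 2) ℂ := !![0, 0; 0, 1]

/-- The 4×4 matrix `D = (ε/2)·A ⊗ E00 + (1/2)·(I₂ − εA) ⊗ E11`, with rows and
columns indexed by histories `(a, b) ∈ Fin 2 × Fin 2`. -/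
noncomputable def Dmat (lam eps : ℝ) :
    Matrix (Fin 2 × Fin 2) (Fin 2 × Fin 2) ℂ :=
  ((eps / 2 : ℂ)) • (Amat lam ⊗ₖ E00) +
    ((1 / 2 : ℂ)) • ((1 - (eps : ℂ) • Amat lam) ⊗ₖ E11)

/-- The `m`-fold Kronecker power `D^{⊗m}` of the 4×4 matrix `D`, with rows and
columns indexed by functions `Fin m → Fin 2 × Fin 2` via the standard
identification. -/
noncomputable def kronPowD (lam eps : ℝ) (m : ℕ) :
    Matrix (Fin m → Fin 2 × Fin 2) (Fin m → Fin 2 × Fin 2) ℂ :=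
  Matrix.of fun f g => ∏ k, Dmat lam eps (f k) (g k)

/-- The 0/1 vector `V = e_{(0,0)}^{⊗n} ⊗ e_{(0,1)} + e_{(1,0)}^{⊗n} ⊗ e_{(1,1)}`
in `ℂ^(4^(n+1))`. -/
def Vvec (n : ℕ) : (Fin (n + 1) → Fin 2 × Fin 2) → ℂ := fun f =>
  (if f = (fun k => if k = Fin.last n then ((0 : Fin 2), (1 : Fin 2)) else (0, 0))
    then 1 else 0) +
  (if f = (fun k => if k = Fin.last n then ((1 : Fin 2), (1 : Fin 2)) else (1, 0))
    then 1 else 0)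

/-- The basis index of the word `(a,0)ⁿ(a,1)`. -/
def wordIdx (n : ℕ) (a : Fin 2) : Fin (n + 1) → Fin 2 × Fin 2 :=
  fun k => if k = Fin.last n then (a, 1) else (a, 0)

theorem Vvec_eq_single (n : ℕ) :
    Vvec n = Pi.single (wordIdx n 0) 1 + Pi.single (wordIdx n 1) 1 := by
  funext f
  simp only [Vvec, Pi.add_apply, Pi.single_apply]
  rfl

theorem wordIdx_ne (n : ℕ) : wordIdx n 0 ≠ wordIdx n 1 := by
  intro h
  have := congrFun h (Fin.last n)
  simp [wordIdx] at this

theorem kronPowD_word (lam eps : ℝ) (n : ℕ) (a b : Fin 2) :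
    kronPowD lam eps (n + 1) (wordIdx n a) (wordIdx n b) =
      (Dmat lam eps (a, 0) (b, 0)) ^ n * Dmat lam eps (a, 1) (b, 1) := by
  simp [kronPowD, Fin.prod_univ_castSucc, wordIdx, Fin.castSucc_ne_last]

theorem quad_eq (lam eps : ℝ) (n : ℕ) :
    star (Vvec n) ⬝ᵥ (kronPowD lam eps (n + 1)).mulVec (Vvec n) =
      (((eps / 2) ^ n * (1 - eps - lam ^ (n + 1) * eps) : ℝ) : ℂ) := by
  have hs : star (Vvec n) = Vvec n := by
    rw [Vvec_eq_single, star_add, ← Pi.single_star, ← Pi.single_star, star_one]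
  rw [hs, Vvec_eq_single, Matrix.mulVec_add, add_dotProduct, dotProduct_add, dotProduct_add]
  simp only [single_one_dotProduct, Matrix.mulVec_single_one, Matrix.col_apply, kronPowD_word]
  simp [Dmat, Amat, E00, E11, Matrix.kroneckerMap_apply]
  ring

/-- For `n ≥ 1` and `λ > 1`, with `ε = 1/(λ^(n+1/2) + 1)` (real power), the
quadratic form of `D^{⊗(n+1)}` at the 0/1 vector `V` is a negative real number;
in particular `D^{⊗(n+1)}` violates the positivity axiom on the 0/1 vector `V`. -/
theorem kronPow_violates_positivity_at_V (n : ℕ) (hn : 1 ≤ n)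
    (lam : ℝ) (hlam : 1 < lam) :
    (∀ i, Vvec n i = 0 ∨ Vvec n i = 1) ∧
    star (Vvec n) ⬝ᵥ
      (kronPowD lam (1 / (lam ^ ((n : ℝ) + 1 / 2) + 1)) (n + 1)).mulVec (Vvec n)
      < 0 := by
  constructor
  · intro i
    rw [Vvec_eq_single, Pi.add_apply, Pi.single_apply, Pi.single_apply]
    by_cases h0 : i = wordIdx n 0
    · have h1 : i ≠ wordIdx n 1 := fun h => wordIdx_ne n (h0.symm.trans h)
      rw [if_pos h0, if_neg h1]
      simp
    · rw [if_neg h0]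
      by_cases h1 : i = wordIdx n 1
      · simp [h1]
      · simp [h1]
  · rw [quad_eq]
    have hpos : 0 < lam ^ ((n : ℝ) + 1 / 2) := Real.rpow_pos_of_pos (by linarith) _
    have hlt : lam ^ ((n : ℝ) + 1 / 2) < lam ^ (n + 1) := by
      rw [← Real.rpow_natCast lam (n + 1)]
      apply Real.rpow_lt_rpow_of_exponent_lt hlam
      push_cast
      linarith
    generalize lam ^ ((n : ℝ) + 1 / 2) = x at *
    have he : 0 < 1 / (x + 1) := by positivity
    have hx : 1 / (x + 1) * (x + 1) = 1 := by field_simp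
    generalize 1 / (x + 1) = e at *
    have h : (e / 2) ^ n * (1 - e - lam ^ (n + 1) * e) < 0 := by
      apply mul_neg_of_pos_of_neg (by positivity)
      nlinarith
    exact_mod_cast h
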